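/- Let n, k be natural numbers and let S be a Presburger-definable subset of ℤ^n × ℤ^k such that for every i ∈ ℤ^n there is at most one q ∈ ℤ^k with (i,q) ∈ S (the relation is single-valued). Let D = {i ∈ ℤ^n | ∃ q, (i,q) ∈ S}. Then D is a Presburger-definable subset of ℤ^n, and there is a piecewise quasi-affine function g defined on D, with values in ℤ^k, such that (i, g i) ∈ S for every i ∈ D. (This is the mathematical core of Proposition 2 of the paper: the affine conditions L on the path to an atomic subtree specify a unique solution for the array indexes q₁,…,q_k as functions of the known variables i₁,…,i_n, and this solution can be found by the affine machinery.) -/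

import Mathlib

/-- An affine function `ℤ^n → ℤ`: `x ↦ b + ∑ i, a i * x i` with integer
coefficients `a i` and integer constant `b`. -/
def IsAffine {n : ℕ} (f : (Fin n → ℤ) → ℤ) : Prop :=
  ∃ (a : Fin n → ℤ) (b : ℤ), ∀ x, f x = b + ∑ i, a i * x i

/-- Presburger-definable subsets of `ℤ^n`: the smallest collection containing
`{x | f x ≥ 0}` for affine `f` and `{x | (m : ℤ) ∣ f x}` for affine `f` and
positive integers `m`, closed under (finite) unions, intersections and
complements. -/
inductive Presburger : ∀ {n : ℕ}, Set (Fin n → ℤ) → Prop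
  | affineGe {n : ℕ} (f : (Fin n → ℤ) → ℤ) (hf : IsAffine f) :
      Presburger {x | 0 ≤ f x}
  | dvd {n : ℕ} (m : ℕ) (hm : 0 < m) (f : (Fin n → ℤ) → ℤ) (hf : IsAffine f) :
      Presburger {x | (m : ℤ) ∣ f x}
  | union {n : ℕ} {S T : Set (Fin n → ℤ)} : Presburger S → Presburger T → Presburger (S ∪ T)
  | inter {n : ℕ} {S T : Set (Fin n → ℤ)} : Presburger S → Presburger T → Presburger (S ∩ T)
  | compl {n : ℕ} {S : Set (Fin n → ℤ)} : Presburger S → Presburger Sᶜ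

/-- Quasi-affine functions `ℤ^n → ℤ`: the smallest collection containing the
coordinate projections and constants, closed under pointwise addition,
subtraction, multiplication by an integer constant, and floor division by a
positive integer. -/
inductive QuasiAffine : ∀ {n : ℕ}, ((Fin n → ℤ) → ℤ) → Prop
  | proj {n : ℕ} (i : Fin n) : QuasiAffine (fun x => x i)
  | const {n : ℕ} (c : ℤ) : QuasiAffine (fun _ : Fin n → ℤ => c)
  | add {n : ℕ} {g h : (Fin n → ℤ) → ℤ} :
      QuasiAffine g → QuasiAffine h → QuasiAffine (fun x => g x + h x)
  | sub {n : ℕ} {g h : (Fin n → ℤ) → ℤ} :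
      QuasiAffine g → QuasiAffine h → QuasiAffine (fun x => g x - h x)
  | smul {n : ℕ} (c : ℤ) {g : (Fin n → ℤ) → ℤ} :
      QuasiAffine g → QuasiAffine (fun x => c * g x)
  | fdiv {n : ℕ} (m : ℕ) (hm : 0 < m) {g : (Fin n → ℤ) → ℤ} :
      QuasiAffine g → QuasiAffine (fun x => Int.fdiv (g x) (m : ℤ))

/-- A scalar-valued function is piecewise quasi-affine on `D`: `D` is a finite
disjoint union of Presburger-definable pieces on each of which the function
agrees with a quasi-affine function. -/
def PiecewiseQuasiAffine {n : ℕ} (D : Set (Fin n → ℤ)) (g : (Fin n → ℤ) → ℤ) : Prop :=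
  ∃ (N : ℕ) (P : Fin N → Set (Fin n → ℤ)) (q : Fin N → (Fin n → ℤ) → ℤ),
    (∀ i, Presburger (P i)) ∧
    (Pairwise fun i j => Disjoint (P i) (P j)) ∧
    (⋃ i, P i) = D ∧
    (∀ i, QuasiAffine (q i)) ∧
    (∀ i, ∀ x ∈ P i, g x = q i x)

/-- A `ℤ^k`-valued function is piecewise quasi-affine on `D`: `D` is a finite
disjoint union of Presburger-definable pieces on each of which every coordinate
of the function agrees with a quasi-affine function. -/
def PiecewiseQuasiAffineVec {n k : ℕ} (D : Set (Fin n → ℤ))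
    (g : (Fin n → ℤ) → (Fin k → ℤ)) : Prop :=
  ∃ (N : ℕ) (P : Fin N → Set (Fin n → ℤ)) (q : Fin N → Fin k → (Fin n → ℤ) → ℤ),
    (∀ i, Presburger (P i)) ∧
    (Pairwise fun i j => Disjoint (P i) (P j)) ∧
    (⋃ i, P i) = D ∧
    (∀ i j, QuasiAffine (q i j)) ∧
    (∀ i, ∀ x ∈ P i, ∀ j, g x j = q i j x)

theorem Int.emod_le_self {a m : ℤ} (hm : 0 < m) (ha : 0 ≤ a) : a % m ≤ a := by
  have := Int.emod_add_mul_ediv a m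
  have := mul_nonneg hm.le (Int.ediv_nonneg ha hm.le)
  omega

namespace IsAffine

variable {n : ℕ} {f g : (Fin n → ℤ) → ℤ}

theorem add (hf : IsAffine f) (hg : IsAffine g) : IsAffine fun x => f x + g x := by
  obtain ⟨a, b, h⟩ := hf
  obtain ⟨a', b', h'⟩ := hg
  refine ⟨fun i => a i + a' i, b + b', fun x => ?_⟩
  simp only [h, h', add_mul, Finset.sum_add_distrib]
  ring

theorem const_mul (c : ℤ) (hf : IsAffine f) : IsAffine fun x => c * f x := by
  obtain ⟨a, b, h⟩ := hf
  refine ⟨fun i => c * a i, c * b, fun x => ?_⟩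
  simp only [h, mul_add, Finset.mul_sum, mul_assoc]

theorem const (c : ℤ) : IsAffine fun _ : Fin n → ℤ => c :=
  ⟨0, c, fun x => by simp⟩

theorem proj (i : Fin n) : IsAffine fun x : Fin n → ℤ => x i :=
  ⟨Pi.single i 1, 0, fun x => by simp [Pi.single_apply]⟩

theorem sub (hf : IsAffine f) (hg : IsAffine g) : IsAffine fun x => f x - g x := by
  simpa [sub_eq_add_neg] using hf.add (hg.const_mul (-1))

end IsAffine

namespace Presburger

variable {n : ℕ}

theorem empty : Presburger (∅ : Set (Fin n → ℤ)) := by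
  have h := affineGe _ (IsAffine.const (n := n) (-1))
  simpa using h

theorem univ : Presburger (Set.univ : Set (Fin n → ℤ)) := by
  simpa using (empty (n := n)).compl

theorem biUnion {ι : Type*} {s : Set ι} (hs : s.Finite) {P : ι → Set (Fin n → ℤ)}
    (hP : ∀ i ∈ s, Presburger (P i)) : Presburger (⋃ i ∈ s, P i) := by
  induction s, hs using Set.Finite.induction_on with
  | empty => simpa using empty
  | insert _ _ ih =>
    rw [Set.biUnion_insert]
    exact (hP _ (Set.mem_insert _ _)).union (ih fun i hi => hP i (Set.mem_insert_of_mem _ hi))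

end Presburger

/-- An integer function with finite range and Presburger-definable level sets. -/
def FinitelyPresburgerValued {n : ℕ} (r : (Fin n → ℤ) → ℤ) : Prop :=
  (Set.range r).Finite ∧ ∀ j, Presburger {x | r x = j}

namespace FinitelyPresburgerValued

variable {n : ℕ} {r s : (Fin n → ℤ) → ℤ}

/-- A set that is Presburger-definable along each level set of `r` is Presburger-definable. -/
theorem presburger_of_fibers (hr : FinitelyPresburgerValued r) {P : ℤ → Set (Fin n → ℤ)}
    (hP : ∀ j, Presburger (P j)) : Presburger {x | x ∈ P (r x)} := by
  convert Presburger.biUnion hr.1 fun j _ => (hr.2 j).inter (hP j) using 1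
  ext x
  simp only [Set.mem_ofPred_eq, Set.mem_iUnion₂, Set.mem_inter_iff]
  exact ⟨fun h => ⟨_, ⟨x, rfl⟩, rfl, h⟩, fun ⟨_, _, hj, h⟩ => hj ▸ h⟩

theorem const (c : ℤ) : FinitelyPresburgerValued fun _ : Fin n → ℤ => c := by
  refine ⟨(Set.finite_singleton c).subset (by rintro _ ⟨x, rfl⟩; rfl), fun j => ?_⟩
  by_cases h : c = j
  · simpa [h] using Presburger.univ
  · simpa [h] using Presburger.empty

theorem map₂ (φ : ℤ → ℤ → ℤ) (hr : FinitelyPresburgerValued r)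
    (hs : FinitelyPresburgerValued s) : FinitelyPresburgerValued fun x => φ (r x) (s x) := by
  refine ⟨(hr.1.image2 φ hs.1).subset ?_, fun j => ?_⟩
  · rintro _ ⟨x, rfl⟩
    exact Set.mem_image2_of_mem ⟨x, rfl⟩ ⟨x, rfl⟩
  · refine hr.presburger_of_fibers (P := fun u => {x | φ u (s x) = j}) fun u => ?_
    refine hs.presburger_of_fibers (P := fun v => {_x | φ u v = j}) fun v => ?_
    exact (const (φ u v)).2 j

theorem emod {a : (Fin n → ℤ) → ℤ} (ha : IsAffine a) {m : ℕ} (hm : 0 < m) :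
    FinitelyPresburgerValued fun x => a x % m := by
  have hm' : (0 : ℤ) < m := by exact_mod_cast hm
  refine ⟨(Set.finite_Ico 0 (m : ℤ)).subset ?_, fun j => ?_⟩
  · rintro _ ⟨x, rfl⟩
    exact ⟨Int.emod_nonneg _ hm'.ne', Int.emod_lt_of_pos _ hm'⟩
  · by_cases hj : 0 ≤ j ∧ j < m
    · convert Presburger.dvd m hm _ (ha.sub (IsAffine.const j)) using 1
      ext x
      simp only [Set.mem_ofPred_eq]
      rw [Int.dvd_iff_emod_eq_zero, ← Int.emod_eq_emod_iff_emod_sub_eq_zero,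
        Int.emod_eq_of_lt hj.1 hj.2]
    · convert Presburger.empty using 1
      ext x
      simp only [Set.mem_ofPred_eq, Set.mem_empty_iff_false, iff_false]
      rintro rfl
      exact hj ⟨Int.emod_nonneg _ hm'.ne', Int.emod_lt_of_pos _ hm'⟩

end FinitelyPresburgerValued

namespace QuasiAffine

variable {n m : ℕ} {g : (Fin n → ℤ) → ℤ}

/-- A positive multiple of a quasi-affine function is affine up to a correction taking finitely
many values. -/
theorem exists_mul_eq_affine_sub (hg : QuasiAffine g) :
    ∃ (M : ℕ) (a r : (Fin n → ℤ) → ℤ), 0 < M ∧ IsAffine a ∧ FinitelyPresburgerValued r ∧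
      ∀ x, M * g x = a x - r x := by
  induction hg with
  | proj i => exact ⟨1, _, _, one_pos, IsAffine.proj i, .const 0, fun x => by simp⟩
  | const c => exact ⟨1, _, _, one_pos, IsAffine.const c, .const 0, fun x => by simp⟩
  | add _ _ ih ih' =>
    obtain ⟨M, a, r, hM, ha, hr, h⟩ := ih
    obtain ⟨M', a', r', hM', ha', hr', h'⟩ := ih'
    refine ⟨M * M', _, _, Nat.mul_pos hM hM', (ha.const_mul M').add (ha'.const_mul M),
      hr.map₂ (fun u v => M' * u + M * v) hr', fun x => ?_⟩
    push_cast
    linear_combination (M' : ℤ) * h x + (M : ℤ) * h' x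
  | sub _ _ ih ih' =>
    obtain ⟨M, a, r, hM, ha, hr, h⟩ := ih
    obtain ⟨M', a', r', hM', ha', hr', h'⟩ := ih'
    refine ⟨M * M', _, _, Nat.mul_pos hM hM', (ha.const_mul M').sub (ha'.const_mul M),
      hr.map₂ (fun u v => M' * u - M * v) hr', fun x => ?_⟩
    push_cast
    linear_combination (M' : ℤ) * h x - (M : ℤ) * h' x
  | smul c _ ih =>
    obtain ⟨M, a, r, hM, ha, hr, h⟩ := ih
    refine ⟨M, _, _, hM, ha.const_mul c, hr.map₂ (fun u _ => c * u) hr, fun x => ?_⟩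
    linear_combination c * h x
  | fdiv m hm _ ih =>
    rename_i g _
    obtain ⟨M, a, r, hM, ha, hr, h⟩ := ih
    have hMm : 0 < M * m := Nat.mul_pos hM hm
    refine ⟨M * m, a, _, hMm, ha,
      hr.map₂ (fun u v => u + (v - u) % (M * m : ℕ)) (.emod ha hMm), fun x => ?_⟩
    have key : (a x % (M * m : ℕ) - r x) % (M * m : ℕ) = M * (g x % m) := by
      rw [Int.emod_sub_emod, ← h x, Nat.cast_mul, Int.mul_emod_mul_of_pos _ _ (by positivity)]
    simp only [key, Int.fdiv_eq_ediv_of_nonneg _ (Int.natCast_nonneg m)]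
    have := Int.emod_add_mul_ediv (g x) m
    push_cast
    linear_combination (M : ℤ) * this + h x

theorem presburger_nonneg (hg : QuasiAffine g) : Presburger {x | 0 ≤ g x} := by
  obtain ⟨M, a, r, hM, ha, hr, h⟩ := hg.exists_mul_eq_affine_sub
  convert hr.presburger_of_fibers fun j => .affineGe _ (ha.sub (.const j)) using 1
  ext x
  simp only [Set.mem_ofPred_eq, ← h x]
  exact (mul_nonneg_iff_of_pos_left (by exact_mod_cast hM)).symm

theorem presburger_dvd (hg : QuasiAffine g) {d : ℕ} (hd : 0 < d) :
    Presburger {x | (d : ℤ) ∣ g x} := by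
  obtain ⟨M, a, r, hM, ha, hr, h⟩ := hg.exists_mul_eq_affine_sub
  convert hr.presburger_of_fibers
    fun j => .dvd (M * d) (Nat.mul_pos hM hd) _ (ha.sub (.const j)) using 1
  ext x
  simp only [Set.mem_ofPred_eq, ← h x, Nat.cast_mul]
  exact (mul_dvd_mul_iff_left (by exact_mod_cast hM.ne')).symm

theorem sum {ι : Type*} (s : Finset ι) {f : ι → (Fin n → ℤ) → ℤ}
    (hf : ∀ i, QuasiAffine (f i)) : QuasiAffine fun x => ∑ i ∈ s, f i x := by
  classical
  induction s using Finset.induction_on with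
  | empty => simpa using const 0
  | insert i s hi ih => simpa only [Finset.sum_insert hi] using (hf i).add ih

theorem affine_comp {f : (Fin m → ℤ) → ℤ} (hf : IsAffine f) {h : Fin m → (Fin n → ℤ) → ℤ}
    (hh : ∀ i, QuasiAffine (h i)) : QuasiAffine fun x => f fun i => h i x := by
  obtain ⟨a, b, hab⟩ := hf
  simpa only [hab] using (const b).add (sum Finset.univ fun i => (hh i).smul (a i))

theorem comp {f : (Fin m → ℤ) → ℤ} (hf : QuasiAffine f) {h : Fin m → (Fin n → ℤ) → ℤ}
    (hh : ∀ i, QuasiAffine (h i)) : QuasiAffine fun x => f fun i => h i x := by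
  induction hf with
  | proj i => exact hh i
  | const c => exact const c
  | add _ _ ih ih' => exact ih.add ih'
  | sub _ _ ih ih' => exact ih.sub ih'
  | smul c _ ih => exact ih.smul c
  | fdiv d hd _ ih => exact ih.fdiv d hd

theorem snoc {h : (Fin n → ℤ) → Fin m → ℤ} (hh : ∀ i, QuasiAffine fun x => h x i)
    (hg : QuasiAffine g) (i : Fin (m + 1)) :
    QuasiAffine fun x => (Fin.snoc (h x) (g x) : Fin (m + 1) → ℤ) i := by
  refine Fin.lastCases ?_ (fun j => ?_) i
  · simpa using hg
  · simpa using hh j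

theorem append_self {h : (Fin n → ℤ) → Fin m → ℤ} (hh : ∀ i, QuasiAffine fun x => h x i)
    (i : Fin (n + m)) : QuasiAffine fun x => Fin.append x (h x) i := by
  refine Fin.addCases (fun j => ?_) (fun j => ?_) i
  · simpa using proj j
  · simpa using hh j

end QuasiAffine

theorem Presburger.preimage {n m : ℕ} {S : Set (Fin m → ℤ)} (hS : Presburger S)
    {h : (Fin n → ℤ) → Fin m → ℤ} (hh : ∀ i, QuasiAffine fun x => h x i) :
    Presburger (h ⁻¹' S) := by
  induction hS with
  | affineGe f hf => exact (QuasiAffine.affine_comp hf hh).presburger_nonneg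
  | dvd d hd f hf => exact (QuasiAffine.affine_comp hf hh).presburger_dvd hd
  | union _ _ ih ih' => exact ih.union ih'
  | inter _ _ ih ih' => exact ih.inter ih'
  | compl _ ih => exact ih.compl

/-- Membership in a Presburger-definable set is periodic in the last coordinate away from finitely
many quasi-affine breakpoints. -/
theorem Presburger.exists_period {n : ℕ} {S : Set (Fin (n + 1) → ℤ)} (hS : Presburger S) :
    ∃ (L : ℤ) (B : Set ((Fin n → ℤ) → ℤ)), 0 < L ∧ B.Finite ∧ (∀ t ∈ B, QuasiAffine t) ∧
      ∀ (x : Fin n → ℤ) (y y' : ℤ), y ≤ y' → L ∣ y' - y → (∀ t ∈ B, t x ≤ y ∨ y' < t x) →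
        ((Fin.snoc x y : Fin (n + 1) → ℤ) ∈ S ↔ (Fin.snoc x y' : Fin (n + 1) → ℤ) ∈ S) := by
  induction hS with
  | affineGe f hf =>
    obtain ⟨a, b, hab⟩ := hf
    have hq : QuasiAffine fun x : Fin n → ℤ => b + ∑ i, a (Fin.castSucc i) * x i :=
      QuasiAffine.affine_comp ⟨fun i => a (Fin.castSucc i), b, fun _ => rfl⟩ .proj
    simp only [Set.mem_ofPred_eq, hab, Fin.sum_univ_castSucc, Fin.snoc_castSucc, Fin.snoc_last,
      ← add_assoc]
    generalize a (Fin.last n) = c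
    obtain ⟨d, rfl | rfl⟩ := c.eq_nat_or_neg
    all_goals
      rcases d.eq_zero_or_pos with rfl | hd
      · exact ⟨1, ∅, one_pos, Set.finite_empty, by simp, by simp⟩
      have hd' : (0 : ℤ) < d := by exact_mod_cast hd
    · refine ⟨1, {fun x => 0 - Int.fdiv (b + ∑ i, a (Fin.castSucc i) * x i) d}, one_pos,
        Set.finite_singleton _, ?_, ?_⟩
      · rintro t rfl
        exact (QuasiAffine.const 0).sub (hq.fdiv d hd)
      · intro x y y' hy _ ht
        have ht := ht _ rfl
        simp only [Int.fdiv_eq_ediv_of_nonneg _ hd'.le] at ht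
        generalize b + ∑ i, a (Fin.castSucc i) * x i = A at *
        have key (z : ℤ) : 0 ≤ A + d * z ↔ 0 - A / d ≤ z := by
          rw [show 0 - A / d ≤ z ↔ -z ≤ A / d by omega, Int.le_ediv_iff_mul_le hd']
          constructor <;> intro <;> linarith
        rw [key, key]
        omega
    · refine ⟨1, {fun x => Int.fdiv (b + ∑ i, a (Fin.castSucc i) * x i) d + 1}, one_pos,
        Set.finite_singleton _, ?_, ?_⟩
      · rintro t rfl
        exact (hq.fdiv d hd).add (QuasiAffine.const 1)
      · intro x y y' hy _ ht
        have ht := ht _ rfl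
        simp only [Int.fdiv_eq_ediv_of_nonneg _ hd'.le] at ht
        generalize b + ∑ i, a (Fin.castSucc i) * x i = A at *
        have key (z : ℤ) : 0 ≤ A + -d * z ↔ z ≤ A / d := by
          rw [Int.le_ediv_iff_mul_le hd']
          constructor <;> intro <;> linarith
        rw [key, key]
        omega
  | dvd m hm f hf =>
    obtain ⟨a, b, hab⟩ := hf
    refine ⟨m, ∅, by exact_mod_cast hm, Set.finite_empty, by simp, fun x y y' _ h _ => ?_⟩
    simp only [Set.mem_ofPred_eq, hab, Fin.sum_univ_castSucc, Fin.snoc_castSucc, Fin.snoc_last]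
    refine (dvd_iff_dvd_of_dvd_sub ?_).symm
    convert h.mul_left (a (Fin.last n)) using 1
    ring
  | union _ _ ih ih' =>
    obtain ⟨L, B, hL, hB, hq, h⟩ := ih
    obtain ⟨L', B', hL', hB', hq', h'⟩ := ih'
    refine ⟨L * L', B ∪ B', mul_pos hL hL', hB.union hB', fun t => Or.rec (hq t) (hq' t),
      fun x y y' hy hd ht => or_congr ?_ ?_⟩
    · exact h x y y' hy (dvd_of_mul_right_dvd hd) fun t h => ht t (.inl h)
    · exact h' x y y' hy (dvd_of_mul_left_dvd hd) fun t h => ht t (.inr h)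
  | inter _ _ ih ih' =>
    obtain ⟨L, B, hL, hB, hq, h⟩ := ih
    obtain ⟨L', B', hL', hB', hq', h'⟩ := ih'
    refine ⟨L * L', B ∪ B', mul_pos hL hL', hB.union hB', fun t => Or.rec (hq t) (hq' t),
      fun x y y' hy hd ht => and_congr ?_ ?_⟩
    · exact h x y y' hy (dvd_of_mul_right_dvd hd) fun t h => ht t (.inl h)
    · exact h' x y y' hy (dvd_of_mul_left_dvd hd) fun t h => ht t (.inr h)
  | compl _ ih =>
    obtain ⟨L, B, hL, hB, hq, h⟩ := ih
    exact ⟨L, B, hL, hB, hq, fun x y y' hy hd ht => not_congr (h x y y' hy hd ht)⟩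

/-- Finitely many quasi-affine functions suffice to witness an existentially quantified last
coordinate. -/
theorem Presburger.exists_finite_witnesses {n : ℕ} {S : Set (Fin (n + 1) → ℤ)}
    (hS : Presburger S) :
    ∃ F : Set ((Fin n → ℤ) → ℤ), F.Finite ∧ (∀ f ∈ F, QuasiAffine f) ∧
      ∀ (x : Fin n → ℤ) (y : ℤ), (Fin.snoc x y : Fin (n + 1) → ℤ) ∈ S →
        ∃ f ∈ F, (Fin.snoc x (f x) : Fin (n + 1) → ℤ) ∈ S := by
  obtain ⟨L, B₀, hL, hB₀, hq₀, hper₀⟩ := hS.exists_period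
  obtain ⟨B, hB, hne, hq, hper⟩ : ∃ B : Set ((Fin n → ℤ) → ℤ), B.Finite ∧ B.Nonempty ∧
      (∀ t ∈ B, QuasiAffine t) ∧
      ∀ (x : Fin n → ℤ) (y y' : ℤ), y ≤ y' → L ∣ y' - y → (∀ t ∈ B, t x ≤ y ∨ y' < t x) →
        ((Fin.snoc x y : Fin (n + 1) → ℤ) ∈ S ↔ (Fin.snoc x y' : Fin (n + 1) → ℤ) ∈ S) := by
    refine ⟨insert (fun _ => 0) B₀, hB₀.insert _, Set.insert_nonempty _ _, ?_, ?_⟩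
    · rintro t (rfl | ht)
      exacts [.const 0, hq₀ t ht]
    · exact fun x y y' hy hd ht => hper₀ x y y' hy hd fun t h => ht t (.inr h)
  refine ⟨Set.image2 (fun t j x => t x + j) B (Set.Ico (-L) L), hB.image2 _ (Set.finite_Ico _ _),
    ?_, fun x y hy => ?_⟩
  · rintro _ ⟨t, ht, j, -, rfl⟩
    exact (hq t ht).add (.const j)
  suffices ∃ t ∈ B, ∃ j ∈ Set.Ico (-L) L, (Fin.snoc x (t x + j) : Fin (n + 1) → ℤ) ∈ S by
    obtain ⟨t, ht, j, hj, h⟩ := this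
    exact ⟨_, ⟨t, ht, j, hj, rfl⟩, h⟩
  by_cases hlow : {t ∈ B | t x ≤ y}.Nonempty
  · obtain ⟨t, ⟨ht, hty⟩, hmax⟩ :=
      Set.exists_max_image _ (fun t => t x) (hB.subset (Set.sep_subset _ _)) hlow
    have h0 := Int.emod_nonneg (y - t x) hL.ne'
    have h1 := Int.emod_lt_of_pos (y - t x) hL
    have h2 := Int.emod_le_self hL (sub_nonneg.2 hty)
    refine ⟨t, ht, (y - t x) % L, ⟨by omega, h1⟩, (hper x _ y (by omega) ?_ ?_).2 hy⟩
    · convert Int.dvd_self_sub_emod (x := y - t x) (m := L) using 1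
      ring
    · intro s hs
      by_cases hsy : s x ≤ y
      · have := hmax s ⟨hs, hsy⟩
        exact .inl (by omega)
      · exact .inr (by omega)
  · have hlow' (t) (ht : t ∈ B) : y < t x := not_le.1 fun h => hlow ⟨t, ht, h⟩
    obtain ⟨t, ht, hmin⟩ := Set.exists_min_image _ (fun t => t x) hB hne
    have hty := hlow' t ht
    have h0 := Int.emod_nonneg (t x - 1 - y) hL.ne'
    have h1 := Int.emod_lt_of_pos (t x - 1 - y) hL
    have h2 := Int.emod_le_self hL (show 0 ≤ t x - 1 - y by omega)
    refine ⟨t, ht, -1 - (t x - 1 - y) % L, ⟨by omega, by omega⟩,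
      (hper x y _ (by omega) ?_ ?_).1 hy⟩
    · convert Int.dvd_self_sub_emod (x := t x - 1 - y) (m := L) using 1
      ring
    · intro s hs
      have := hmin s hs
      exact .inr (by omega)

/-- Finitely many quasi-affine maps suffice to witness a block of existentially quantified
coordinates. -/
theorem Presburger.exists_finite_witnesses_append {n k : ℕ} {S : Set (Fin (n + k) → ℤ)}
    (hS : Presburger S) :
    ∃ F : Set ((Fin n → ℤ) → Fin k → ℤ), F.Finite ∧ (∀ f ∈ F, ∀ j, QuasiAffine fun x => f x j) ∧
      ∀ (x : Fin n → ℤ) (q : Fin k → ℤ), Fin.append x q ∈ S →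
        ∃ f ∈ F, Fin.append x (f x) ∈ S := by
  induction k with
  | zero =>
    refine ⟨{fun _ => Fin.elim0}, Set.finite_singleton _, fun f _ j => j.elim0,
      fun x q h => ⟨_, rfl, ?_⟩⟩
    rwa [Subsingleton.elim Fin.elim0 q]
  | succ k ih =>
    obtain ⟨F, hF, hFq, hFw⟩ := Presburger.exists_finite_witnesses (n := n + k) hS
    obtain ⟨G, hG, hGq, hGw⟩ := ih <| Presburger.biUnion hF fun f hf =>
      hS.preimage (QuasiAffine.snoc (h := fun z : Fin (n + k) → ℤ => z) .proj (hFq f hf))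
    refine ⟨Set.image2 (fun g f x => Fin.snoc (g x) (f (Fin.append x (g x)))) G F,
      hG.image2 _ hF, ?_, fun x q h => ?_⟩
    · rintro _ ⟨g, hg, f, hf, rfl⟩
      exact QuasiAffine.snoc (hGq g hg) ((hFq f hf).comp (QuasiAffine.append_self (hGq g hg)))
    · rw [← Fin.snoc_init_self q, Fin.append_snoc] at h
      obtain ⟨f, hf, h⟩ := hFw _ _ h
      obtain ⟨g, hg, h⟩ := hGw x (Fin.init q) (Set.mem_biUnion hf h)
      obtain ⟨f, hf, h⟩ := Set.mem_iUnion₂.1 h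
      refine ⟨_, ⟨g, hg, f, hf, rfl⟩, ?_⟩
      rw [Fin.append_snoc]
      exact h

/-- **Single-valued affine relations have piecewise quasi-affine solutions**
(the mathematical core of Proposition 2 of the paper).  If `S ⊆ ℤ^n × ℤ^k`
(pairs encoded via `Fin.append`) is Presburger-definable and single-valued,
then its domain `D` is Presburger-definable and there is a piecewise
quasi-affine function `g` on `D` selecting, for each `i ∈ D`, the unique `q`
with `(i, q) ∈ S`. -/
theorem single_valued_affine_solution (n k : ℕ) (S : Set (Fin (n + k) → ℤ))
    (hS : Presburger S)
    (hsv : ∀ (i : Fin n → ℤ) (q q' : Fin k → ℤ),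
      Fin.append i q ∈ S → Fin.append i q' ∈ S → q = q')
    (D : Set (Fin n → ℤ))
    (hD : D = {i | ∃ q : Fin k → ℤ, Fin.append i q ∈ S}) :
    Presburger D ∧
    ∃ g : (Fin n → ℤ) → (Fin k → ℤ),
      PiecewiseQuasiAffineVec D g ∧
      ∀ i ∈ D, Fin.append i (g i) ∈ S := by
  subst hD
  obtain ⟨F, hF, hFq, hFw⟩ := hS.exists_finite_witnesses_append
  obtain ⟨N, F, -, rfl⟩ := hF.fin_param
  let E (i : Fin N) : Set (Fin n → ℤ) := {x | Fin.append x (F i x) ∈ S}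
  have hE (i : Fin N) : Presburger (E i) :=
    hS.preimage (QuasiAffine.append_self (hFq _ ⟨i, rfl⟩))
  have hU : ⋃ i, disjointed E i = {x | ∃ q : Fin k → ℤ, Fin.append x q ∈ S} := by
    rw [iUnion_disjointed]
    ext x
    simp only [Set.mem_iUnion, Set.mem_ofPred_eq]
    refine ⟨fun ⟨i, hi⟩ => ⟨_, hi⟩, fun ⟨q, hq⟩ => ?_⟩
    obtain ⟨_, ⟨i, rfl⟩, hi⟩ := hFw x q hq
    exact ⟨i, hi⟩
  have hP (i : Fin N) : Presburger (disjointed E i) := by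
    rw [disjointed_apply, Finset.sup_set_eq_biUnion]
    exact (hE i).inter (Presburger.biUnion (Finset.finite_toSet _) fun j _ => hE j).compl
  have hg (x : Fin n → ℤ) (hx : ∃ q : Fin k → ℤ, Fin.append x q ∈ S) :
      Fin.append x (Classical.epsilon fun q => Fin.append x q ∈ S) ∈ S :=
    Classical.epsilon_spec hx
  refine ⟨?_, fun x => Classical.epsilon fun q => Fin.append x q ∈ S, ?_, hg⟩
  · rw [← hU, ← Set.biUnion_univ]
    exact Presburger.biUnion Set.finite_univ fun i _ => hP i
  · refine ⟨N, disjointed E, fun i j x => F i x j, hP, disjoint_disjointed E, hU,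
      fun i => hFq _ ⟨i, rfl⟩, fun i x hx j => ?_⟩
    have hx : Fin.append x (F i x) ∈ S := disjointed_le E i hx
    exact congrFun (hsv x _ _ (hg x ⟨_, hx⟩) hx) j
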